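/- arXiv:2602.13922 — 3 statements merged into one kernel-verified Lean document; each statement's English description precedes it below -/
import Mathlib

section
/- Let H, L_1, ..., L_m be Hermitian n×n complex matrices, let γ_1, ..., γ_m be strictly positive real numbers, and let ħ > 0. Define the dephasing Lindblad generator L(ρ) = −(i/ħ)[H,ρ] − (1/(2ħ²)) ∑_{j=1}^m γ_j [L_j,[L_j,ρ]]. Then Tr(H · L(ρ)) = 0 for every density matrix ρ (i.e., every positive semidefinite Hermitian n×n complex matrix with trace 1) if and only if [H, L_j] = 0 for all j = 1, ..., m. -/
open ComplexOrder

/-- The dephasing Lindblad generator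
`L(ρ) = −(i/hbar)[H,ρ] − (1/(2hbar²)) ∑_j γ_j [L_j,[L_j,ρ]]`. -/
noncomputable def lindbladGen {n m : ℕ} (H : Matrix (Fin n) (Fin n) ℂ)
    (L : Fin m → Matrix (Fin n) (Fin n) ℂ) (γ : Fin m → ℝ) (hbar : ℝ)
    (ρ : Matrix (Fin n) (Fin n) ℂ) : Matrix (Fin n) (Fin n) ℂ :=
  (-(Complex.I / (hbar : ℂ))) • (H * ρ - ρ * H) -
    ((1 : ℂ) / (2 * (hbar : ℂ) ^ 2)) •
      ∑ j, (γ j : ℂ) • (L j * (L j * ρ - ρ * L j) - (L j * ρ - ρ * L j) * L j)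

/-- The double-commutator observable `∑ γ_j [L_j,[L_j,H]]`. -/
noncomputable def dualObs {n m : ℕ} (H : Matrix (Fin n) (Fin n) ℂ)
    (L : Fin m → Matrix (Fin n) (Fin n) ℂ) (γ : Fin m → ℝ) : Matrix (Fin n) (Fin n) ℂ :=
  ∑ j, (γ j : ℂ) • (L j * (L j * H - H * L j) - (L j * H - H * L j) * L j)

lemma trace_double_comm {n : ℕ} (H A ρ : Matrix (Fin n) (Fin n) ℂ) :
    (H * (A * (A * ρ - ρ * A) - (A * ρ - ρ * A) * A)).trace =
      ((A * (A * H - H * A) - (A * H - H * A) * A) * ρ).trace := by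
  have h1 : (H * (ρ * (A * A))).trace = (A * (A * (H * ρ))).trace := by
    rw [← Matrix.mul_assoc, Matrix.trace_mul_comm, Matrix.mul_assoc]
  have h2 : (H * (A * (ρ * A))).trace = (A * (H * (A * ρ))).trace := by
    rw [← Matrix.mul_assoc, ← Matrix.mul_assoc, Matrix.trace_mul_comm, Matrix.mul_assoc]
  simp only [Matrix.mul_sub, Matrix.sub_mul, Matrix.trace_sub, Matrix.mul_assoc, h1, h2]
  ring

lemma trace_gen {n m : ℕ} (H : Matrix (Fin n) (Fin n) ℂ)
    (L : Fin m → Matrix (Fin n) (Fin n) ℂ) (γ : Fin m → ℝ) (hbar : ℝ)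
    (ρ : Matrix (Fin n) (Fin n) ℂ) :
    (H * lindbladGen H L γ hbar ρ).trace =
      -((1 : ℂ) / (2 * (hbar : ℂ) ^ 2)) * (dualObs H L γ * ρ).trace := by
  have h0 : (H * (H * ρ - ρ * H)).trace = 0 := by
    rw [Matrix.mul_sub, Matrix.trace_sub, ← Matrix.mul_assoc H ρ H, Matrix.trace_mul_comm (H * ρ) H,
      sub_self]
  unfold lindbladGen dualObs
  rw [Matrix.mul_sub, Matrix.trace_sub, Matrix.mul_smul, Matrix.trace_smul, h0, Matrix.mul_smul,
    Matrix.trace_smul, Matrix.mul_sum, Matrix.sum_mul, Matrix.trace_sum, Matrix.trace_sum]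
  simp only [Matrix.mul_smul, Matrix.smul_mul, Matrix.trace_smul, trace_double_comm,
    smul_eq_mul, neg_mul]
  ring

lemma trace_sq {n : ℕ} (H A : Matrix (Fin n) (Fin n) ℂ) (hH : H.IsHermitian)
    (hA : A.IsHermitian) :
    ((A * (A * H - H * A) - (A * H - H * A) * A) * H).trace =
      ((H * A - A * H).conjTranspose * (H * A - A * H)).trace := by
  have hc : (H * A - A * H).conjTranspose = A * H - H * A := by
    rw [Matrix.conjTranspose_sub, Matrix.conjTranspose_mul, Matrix.conjTranspose_mul, hH.eq, hA.eq]
  rw [hc, Matrix.sub_mul, Matrix.trace_sub, Matrix.mul_assoc A, Matrix.trace_mul_comm A,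
    Matrix.mul_sub, Matrix.trace_sub]
  simp only [Matrix.mul_assoc]

theorem energy_conserved_iff_commute (n m : ℕ)
    (H : Matrix (Fin n) (Fin n) ℂ) (L : Fin m → Matrix (Fin n) (Fin n) ℂ)
    (γ : Fin m → ℝ) (hbar : ℝ)
    (hH : H.IsHermitian) (hL : ∀ j, (L j).IsHermitian)
    (hγ : ∀ j, 0 < γ j) (hhbar : 0 < hbar) :
    (∀ ρ : Matrix (Fin n) (Fin n) ℂ, ρ.PosSemidef → ρ.trace = 1 →
        (H * lindbladGen H L γ hbar ρ).trace = 0) ↔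
      ∀ j, H * L j - L j * H = 0 := by
  have hb : (hbar : ℂ) ≠ 0 := by exact_mod_cast hhbar.ne'
  constructor
  · intro h
    have hd : ∀ ρ : Matrix (Fin n) (Fin n) ℂ, ρ.PosSemidef → ρ.trace = 1 →
        (dualObs H L γ * ρ).trace = 0 := by
      intro ρ h1 h2
      have := h ρ h1 h2
      rw [trace_gen] at this
      refine (mul_eq_zero.mp this).resolve_left ?_
      simp [hb]
    have hp : ∀ ρ : Matrix (Fin n) (Fin n) ℂ, ρ.PosSemidef →
        (dualObs H L γ * ρ).trace = 0 := by
      intro ρ h1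
      by_cases ht : ρ.trace = 0
      · rw [h1.trace_eq_zero_iff.mp ht]; simp
      · have h2 := hd (ρ.trace⁻¹ • ρ) (h1.smul (inv_nonneg.mpr h1.trace_nonneg))
          (by rw [Matrix.trace_smul, smul_eq_mul, inv_mul_cancel₀ ht])
        rw [Matrix.mul_smul, Matrix.trace_smul, smul_eq_mul] at h2
        exact (mul_eq_zero.mp h2).resolve_left (inv_ne_zero ht)
    have hHz : (dualObs H L γ * H).trace = 0 := by
      have e1 := hp _ (Matrix.posSemidef_conjTranspose_mul_self (H + 1))
      have e2 := hp _ (Matrix.posSemidef_conjTranspose_mul_self (H - 1))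
      have e : (4 : ℂ) • H = (H + 1).conjTranspose * (H + 1) - (H - 1).conjTranspose * (H - 1) := by
        rw [Matrix.conjTranspose_add, Matrix.conjTranspose_sub, hH.eq, Matrix.conjTranspose_one]
        have : (4 : ℂ) • H = H + H + H + H := by module
        rw [this]; noncomm_ring
      have e3 : (dualObs H L γ * ((4 : ℂ) • H)).trace = 0 := by
        rw [e, Matrix.mul_sub, Matrix.trace_sub, e1, e2, sub_zero]
      rw [Matrix.mul_smul, Matrix.trace_smul, smul_eq_mul] at e3
      exact (mul_eq_zero.mp e3).resolve_left (by norm_num)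
    unfold dualObs at hHz
    rw [Matrix.sum_mul, Matrix.trace_sum] at hHz
    simp only [Matrix.smul_mul, Matrix.trace_smul, smul_eq_mul] at hHz
    have hg : ∀ j, (0 : ℂ) < (γ j : ℂ) := fun j => by exact_mod_cast hγ j
    rw [Finset.sum_eq_zero_iff_of_nonneg] at hHz
    · intro j
      have h3 := (mul_eq_zero.mp (hHz j (Finset.mem_univ j))).resolve_left (hg j).ne'
      rw [trace_sq H (L j) hH (hL j)] at h3
      exact Matrix.trace_conjTranspose_mul_self_eq_zero_iff.mp h3
    · intro j _
      rw [trace_sq H (L j) hH (hL j)]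
      exact mul_nonneg (hg j).le (Matrix.posSemidef_conjTranspose_mul_self _).trace_nonneg
  · intro h ρ _ _
    have : dualObs H L γ = 0 := by
      unfold dualObs
      refine Finset.sum_eq_zero fun j _ => ?_
      have : L j * H - H * L j = 0 := by rw [← neg_sub, h j, neg_zero]
      simp [this]
    rw [trace_gen, this]; simp
end

section
/- Let H, L_1, ..., L_m be Hermitian n×n complex matrices and let γ_1, ..., γ_m be strictly positive real numbers. If ∑_{j=1}^m γ_j [L_j,[L_j,H]] = 0, then [L_j, H] = 0 for every j = 1, ..., m. -/
open scoped ComplexOrder Matrix in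
/-- If `H` and the `L j` are Hermitian, the `γ j` are strictly positive, and
`∑ j, γ j • [L j, [L j, H]] = 0`, then `[L j, H] = 0` for every `j`. -/
theorem commutes_of_sum_double_commutator_eq_zero (n m : ℕ)
    (H : Matrix (Fin n) (Fin n) ℂ) (L : Fin m → Matrix (Fin n) (Fin n) ℂ)
    (γ : Fin m → ℝ) (hH : H.IsHermitian) (hL : ∀ j, (L j).IsHermitian)
    (hγ : ∀ j, 0 < γ j)
    (hsum : ∑ j, (γ j : ℂ) •
        (L j * (L j * H - H * L j) - (L j * H - H * L j) * L j) = 0) :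
    ∀ j, L j * H - H * L j = 0 := by
  have hC : ∀ j, (L j * H - H * L j)ᴴ = H * L j - L j * H := by
    intro j
    rw [Matrix.conjTranspose_sub, Matrix.conjTranspose_mul, Matrix.conjTranspose_mul,
      hH.eq, (hL j).eq]
  have key : ∀ j, (H * (L j * (L j * H - H * L j) - (L j * H - H * L j) * L j)).trace
      = ((L j * H - H * L j)ᴴ * (L j * H - H * L j)).trace := by
    intro j
    rw [hC j]
    generalize L j * H - H * L j = C
    rw [mul_sub, sub_mul, Matrix.trace_sub, Matrix.trace_sub, ← mul_assoc, ← mul_assoc,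
      Matrix.trace_mul_comm (H * C) (L j), ← mul_assoc]
  have h0 : ∑ j, (γ j : ℂ) * ((L j * H - H * L j)ᴴ * (L j * H - H * L j)).trace = 0 := by
    have h := congrArg (fun X => (H * X).trace) hsum
    simp only [Finset.mul_sum, Matrix.trace_sum, Matrix.mul_smul, Matrix.trace_smul, key,
      smul_eq_mul, mul_zero, Matrix.trace_zero] at h
    exact h
  have hpos : ∀ j, (0 : ℂ) < γ j := fun j => by exact_mod_cast hγ j
  rw [Finset.sum_eq_zero_iff_of_nonneg (fun j _ => mul_nonneg (hpos j).le
    (Matrix.posSemidef_conjTranspose_mul_self _).trace_nonneg)] at h0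
  intro j
  have h := (mul_eq_zero.mp (h0 j (Finset.mem_univ j))).resolve_left (hpos j).ne'
  exact Matrix.trace_conjTranspose_mul_self_eq_zero_iff.mp h
end

section
/- Let ħ > 0, E_1, ..., E_n real, H = diag(E_1, ..., E_n), L_j = diag(a_j^1, ..., a_j^n) with real entries and real rates γ_j for j = 1, ..., m, and set Γ_{k,i} = (1/(2ħ²)) ∑_j γ_j (a_j^k − a_j^i)². Let ρ⁰ be any n×n complex matrix and define ρ(t) entrywise by ρ_{k,i}(t) = exp(−(i(E_k − E_i)/ħ + Γ_{k,i}) t) · ρ⁰_{k,i}. Then ρ(0) = ρ⁰ and ρ is differentiable with ρ'(t) = −(i/ħ)[H,ρ(t)] − (1/(2ħ²)) ∑_j γ_j [L_j,[L_j,ρ(t)]] for all real t. -/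
/-- With diagonal `H = diag(E)`, diagonal `L j = diag(a j)`, and
`Γ_{k,i} = (1/(2ħ²)) ∑_j γ_j (a_j^k − a_j^i)²`, the entrywise exponential ansatz
`ρ_{k,i}(t) = exp(−(i(E_k−E_i)/ħ + Γ_{k,i})t)·ρ⁰_{k,i}` satisfies `ρ(0) = ρ⁰` and
solves the dephasing Lindblad equation. -/
theorem dephasing_solution (n m : ℕ) (hbar : ℝ) (hhbar : 0 < hbar)
    (E : Fin n → ℝ) (a : Fin m → Fin n → ℝ) (γ : Fin m → ℝ)
    (ρ0 : Matrix (Fin n) (Fin n) ℂ) (ρ : ℝ → Matrix (Fin n) (Fin n) ℂ)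
    (hρ : ∀ t : ℝ, ∀ k i, ρ t k i =
      Complex.exp (-(Complex.I * ((E k : ℂ) - (E i : ℂ)) / (hbar : ℂ)
          + (((1 / (2 * hbar ^ 2)) * ∑ j, γ j * (a j k - a j i) ^ 2 : ℝ) : ℂ)) * (t : ℂ))
        * ρ0 k i) :
    ρ 0 = ρ0 ∧
      ∀ t : ℝ, ∀ k i, HasDerivAt (fun s => ρ s k i)
        (lindbladGen (Matrix.diagonal fun l => (E l : ℂ))
          (fun j => Matrix.diagonal fun l => (a j l : ℂ)) γ hbar (ρ t) k i) t := by
  refine ⟨?_, ?_⟩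
  · ext k i
    rw [hρ]
    simp
  · intro t k i
    have hgen : lindbladGen (Matrix.diagonal fun l => (E l : ℂ))
          (fun j => Matrix.diagonal fun l => (a j l : ℂ)) γ hbar (ρ t) k i =
        -(Complex.I * ((E k : ℂ) - (E i : ℂ)) / (hbar : ℂ)
          + (((1 / (2 * hbar ^ 2)) * ∑ j, γ j * (a j k - a j i) ^ 2 : ℝ) : ℂ)) * ρ t k i := by
      have hsum : ∑ j, (γ j : ℂ) * ((a j k : ℂ) * ((a j k : ℂ) * ρ t k i - ρ t k i * (a j i : ℂ))
          - ((a j k : ℂ) * ρ t k i - ρ t k i * (a j i : ℂ)) * (a j i : ℂ)) =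
          (∑ j, (γ j : ℂ) * ((a j k : ℂ) - (a j i : ℂ)) ^ 2) * ρ t k i := by
        rw [Finset.sum_mul]
        refine Finset.sum_congr rfl fun j _ => ?_
        ring
      simp only [lindbladGen, Matrix.sub_apply, Matrix.smul_apply, Matrix.sum_apply,
        Matrix.diagonal_mul, Matrix.mul_diagonal, smul_eq_mul]
      rw [hsum]
      push_cast
      ring
    rw [hgen, hρ t k i]
    have hf : (fun s => ρ s k i) = fun s : ℝ => _ := funext fun s => hρ s k i
    rw [hf]
    generalize -(Complex.I * ((E k : ℂ) - (E i : ℂ)) / (hbar : ℂ)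
          + (((1 / (2 * hbar ^ 2)) * ∑ j, γ j * (a j k - a j i) ^ 2 : ℝ) : ℂ)) = c
    have h1 : HasDerivAt (fun s : ℝ => c * (s : ℂ)) c t := by
      simpa using (Complex.ofRealCLM.hasDerivAt (x := t)).const_mul c
    have h2 := (h1.cexp).mul_const (ρ0 k i)
    exact h2.congr_deriv (by ring)
end
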